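/- Every terminal game Γ=(G,v₀,𝓛) satisfying (TWO) n=2 players, (SYM) G is edge-symmetric, and (CIW) 𝓛ⁱ(w)<0 for every player i and terminal w, has a uniform Nash equilibrium in pure stationary strategies. -/

import Mathlib

open scoped Classical

section CoreDefs

variable {V : Type}

/-- A position is terminal iff it has no outgoing edges. -/
def Terminal (E : V → V → Prop) (v : V) : Prop := ∀ u, ¬ E v u

/-- A situation (profile of pure stationary strategies), encoded as a single
successor map: at every non-terminal position it must follow an edge. -/
def IsSituation (E : V → V → Prop) (s : V → V) : Prop :=
  ∀ v, ¬ Terminal E v → E v (s v)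

/-- `s'` is a unilateral deviation of player `i` from `s`: they agree at every
position not controlled by `i` (terminals are controlled by nobody). -/
def Deviation {n : ℕ} (E : V → V → Prop) (owner : V → Fin n) (i : Fin n)
    (s s' : V → V) : Prop :=
  ∀ v, (owner v ≠ i ∨ Terminal E v) → s' v = s v

/-- The play of `s` started at `v` reaches a terminal position. -/
def Reaches (E : V → V → Prop) (s : V → V) (v : V) : Prop :=
  ∃ k, Terminal E (s^[k] v)

/-- First time the play of `s` from `v` is at a terminal position. -/
noncomputable def stopTime (E : V → V → Prop) (s : V → V) (v : V) : ℕ :=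
  sInf {k | Terminal E (s^[k] v)}

/-- The terminal position reached by the play of `s` from `v` (junk if none). -/
noncomputable def playEnd (E : V → V → Prop) (s : V → V) (v : V) : V :=
  s^[stopTime E s v] v

/-- Effective cost in a terminal game: the cost of the terminal reached,
`0` for an infinite play. -/
noncomputable def tCost (E : V → V → Prop) (L : V → ℝ) (s : V → V) (v : V) : ℝ :=
  if Reaches E s v then L (playEnd E s v) else 0

/-- Effective cost in a positive shortest path game: the total length of the
play if it terminates, `+∞` for an infinite play. -/
noncomputable def spCost (E : V → V → Prop) (l : V → V → ℝ) (s : V → V) (v : V) : EReal :=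
  if Reaches E s v then
    (((Finset.range (stopTime E s v)).sum fun k => l (s^[k] v) (s^[k+1] v) : ℝ) : EReal)
  else ⊤

/-- Edge-symmetry: every move can be reversed, except moves entering terminals. -/
def EdgeSymm (E : V → V → Prop) : Prop :=
  ∀ u v, E u v → ¬ Terminal E v → E v u

end CoreDefs
section UniformDefs

variable {V : Type}

/-- `s` is a situation in which player `i`'s strategy is a uniform best
response to the opponents' strategies: no unilateral deviation of `i`
improves `i`'s cost from any initial position. -/
def UBR {n : ℕ} (E : V → V → Prop) (owner : V → Fin n) (L : Fin n → V → ℝ)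
    (i : Fin n) (s : V → V) : Prop :=
  ∀ s', IsSituation E s' → Deviation E owner i s s' →
    ∀ v, tCost E (L i) s v ≤ tCost E (L i) s' v

/-- `s'` is obtained from `s` by a uniform best improvement of player `i`. -/
def UBI {n : ℕ} (E : V → V → Prop) (owner : V → Fin n) (L : Fin n → V → ℝ)
    (i : Fin n) (s s' : V → V) : Prop :=
  IsSituation E s' ∧ Deviation E owner i s s' ∧ s' ≠ s ∧
  UBR E owner L i s' ∧
  ∀ v, owner v = i → ¬ Terminal E v →
    s' v = s v ∨ tCost E (L i) s' v < tCost E (L i) s v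

/-- `s` is `i`-basic: every position `v` with a terminal out-neighbour `w`
either uses the terminal move, or every uniform best improvement of player `i`
gives the owner of `v` a strictly better value at `v` than that terminal. -/
def IBasic {n : ℕ} (E : V → V → Prop) (owner : V → Fin n) (L : Fin n → V → ℝ)
    (i : Fin n) (s : V → V) : Prop :=
  ∀ v w, E v w → Terminal E w →
    s v = w ∨ ∀ s', UBI E owner L i s s' → tCost E (L (owner v)) s' v < L (owner v) w

/-- (S1): every edge between two distinct non-terminal vertices joins positions
of different players. -/
def CondS1 {n : ℕ} (E : V → V → Prop) (owner : V → Fin n) : Prop :=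
  ∀ u v, E u v → u ≠ v → ¬ Terminal E u → ¬ Terminal E v → owner u ≠ owner v

/-- (S2): every position has at most one terminal out-neighbour. -/
def CondS2 (E : V → V → Prop) : Prop :=
  ∀ v w w', E v w → E v w' → Terminal E w → Terminal E w' → w = w'

/-- (S3): a terminal position is reachable from every position. -/
def CondS3 (E : V → V → Prop) : Prop :=
  ∀ v : V, ∃ w, Terminal E w ∧ Relation.ReflTransGen E v w

/-- Uniform Nash equilibrium: a situation that is a Nash equilibrium for every
choice of the initial position. -/
def IsUNE {n : ℕ} (E : V → V → Prop) (owner : V → Fin n) (L : Fin n → V → ℝ)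
    (s : V → V) : Prop :=
  IsSituation E s ∧ ∀ i s', IsSituation E s' → Deviation E owner i s s' →
    ∀ v, tCost E (L i) s v ≤ tCost E (L i) s' v

end UniformDefs

section PlayCost

variable {V : Type} {E : V → V → Prop} {L f : V → ℝ} {s : V → V} {v : V}

lemma terminal_playEnd (h : Reaches E s v) : Terminal E (playEnd E s v) :=
  Nat.sInf_mem (s := {k | Terminal E (s^[k] v)}) h

lemma rel_iterate_of_le_stopTime {r : V → V → Prop} (hrefl : ∀ x, r x x)
    (htrans : ∀ x y z, r x y → r y z → r x z) (hs : ∀ x, ¬ Terminal E x → r x (s x))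
    (k : ℕ) (hk : k ≤ stopTime E s v) : r v (s^[k] v) := by
  induction k with
  | zero => exact hrefl v
  | succ k ih =>
    rw [Function.iterate_succ_apply']
    exact htrans _ _ _ (ih (by omega)) (hs _ (Nat.notMem_of_lt_sInf (Nat.lt_of_succ_le hk)))

/-- A nonpositive function extending the terminal costs that does not decrease along the play
bounds the effective cost from below. -/
lemma le_tCost (hf : ∀ x, f x ≤ 0) (hL : ∀ w, Terminal E w → f w = L w)
    (hs : ∀ x, ¬ Terminal E x → f x ≤ f (s x)) : f v ≤ tCost E L s v := by
  unfold tCost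
  split_ifs with h
  · rw [← hL _ (terminal_playEnd h)]
    exact rel_iterate_of_le_stopTime (r := fun x y => f x ≤ f y) (fun _ => le_rfl)
      (fun _ _ _ => le_trans) hs _ le_rfl
  · exact hf v

/-- A function extending the terminal costs that is constant along the play, and nonnegative
if the play is infinite, bounds the effective cost from above. -/
lemma tCost_le (hL : ∀ w, Terminal E w → f w = L w)
    (hs : ∀ x, ¬ Terminal E x → f x = f (s x)) (h0 : ¬ Reaches E s v → 0 ≤ f v) :
    tCost E L s v ≤ f v := by
  unfold tCost
  split_ifs with h
  · rw [← hL _ (terminal_playEnd h)]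
    exact (rel_iterate_of_le_stopTime (r := fun x y => f x = f y) (fun _ => rfl)
      (fun _ _ _ => Eq.trans) hs _ le_rfl).ge
  · exact h0 h

end PlayCost

section LocalOptimality

variable {V : Type} {E : V → V → Prop} {n : ℕ} {owner : V → Fin n} {L : Fin n → V → ℝ}

/-- A situation along which `val` is constant is a uniform Nash equilibrium as soon as no single
move improves `val` for the player who makes it. -/
lemma isUNE_of_locally_optimal {s : V → V} {val : V → Fin n → ℝ} (hs : IsSituation E s)
    (hneg : ∀ x i, val x i ≤ 0) (hL : ∀ w, Terminal E w → ∀ i, val w i = L i w)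
    (hconst : ∀ x, ¬ Terminal E x → val x = val (s x))
    (hinf : ∀ x, ¬ Reaches E s x → ∀ i, 0 ≤ val x i)
    (hopt : ∀ x y, E x y → val x (owner x) ≤ val y (owner x)) : IsUNE E owner L s := by
  refine ⟨hs, fun i s' hs' hdev v => ?_⟩
  refine (tCost_le (f := fun x => val x i) (fun w hw => hL w hw i)
    (fun x hx => congrFun (hconst x hx) i) (fun h => hinf v h i)).trans ?_
  refine le_tCost (f := fun x => val x i) (fun x => hneg x i) (fun w hw => hL w hw i) ?_
  intro x hx
  by_cases hi : owner x = i
  · subst hi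
    exact hopt x _ (hs' x hx)
  · rw [hdev x (Or.inl hi)]
    exact (congrFun (hconst x hx) i).le

/-- There is a terminal that can be reached from `v` in `k` steps of `S`. -/
def TerminalWithin (E S : V → V → Prop) : ℕ → V → Prop
  | 0, v => Terminal E v
  | k + 1, v => ∃ u, S v u ∧ TerminalWithin E S k u

/-- If terminals are reachable along `S`, they are reached by a stationary strategy along `S`. -/
lemma exists_reaching_strategy (E S : V → V → Prop) (g : V → V) :
    ∃ s : V → V,
      (∀ v, ¬ Terminal E v → (∃ w, Terminal E w ∧ Relation.ReflTransGen S v w) →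
        S v (s v) ∧ Reaches E s v) ∧
      ∀ v, (¬ ∃ w, Terminal E w ∧ Relation.ReflTransGen S v w) → s v = g v := by
  have hit : ∀ v w, Terminal E w → Relation.ReflTransGen S v w →
      ∃ k, TerminalWithin E S k v := by
    intro v w hw h
    induction h using Relation.ReflTransGen.head_induction_on with
    | refl => exact ⟨0, hw⟩
    | head h _ ih =>
      obtain ⟨k, hk⟩ := ih
      exact ⟨k + 1, _, h, hk⟩
  have unhit : ∀ k v, TerminalWithin E S k v →
      ∃ w, Terminal E w ∧ Relation.ReflTransGen S v w := by
    intro k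
    induction k with
    | zero => exact fun v hv => ⟨v, hv, .refl⟩
    | succ k ih =>
      rintro v ⟨u, hu, hk⟩
      obtain ⟨w, hw, h⟩ := ih u hk
      exact ⟨w, hw, .head hu h⟩
  let rank : V → ℕ := fun v => sInf {k | TerminalWithin E S k v}
  have step : ∀ v, ∃ u, (¬ Terminal E v → (∃ w, Terminal E w ∧ Relation.ReflTransGen S v w) →
      S v u ∧ (∃ k, TerminalWithin E S k u) ∧ rank u < rank v) ∧
      ((¬ ∃ w, Terminal E w ∧ Relation.ReflTransGen S v w) → u = g v) := by
    intro v
    by_cases hv : ¬ Terminal E v ∧ ∃ w, Terminal E w ∧ Relation.ReflTransGen S v w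
    · obtain ⟨hv, w, hw, h⟩ := hv
      have hmem : TerminalWithin E S (rank v) v :=
        Nat.sInf_mem (s := {k | TerminalWithin E S k v}) (hit v w hw h)
      rcases hr : rank v with _ | m
      · rw [hr] at hmem
        exact absurd hmem hv
      · rw [hr] at hmem
        obtain ⟨u, hu, hm⟩ := hmem
        refine ⟨u, fun _ _ => ⟨hu, ⟨_, hm⟩, ?_⟩, fun h' => absurd ⟨w, hw, h⟩ h'⟩
        have : rank u ≤ m := Nat.sInf_le hm
        omega
    · exact ⟨g v, fun h1 h2 => absurd ⟨h1, h2⟩ hv, fun _ => rfl⟩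
  choose s hs hg using step
  refine ⟨s, ?_, hg⟩
  have reach : ∀ m v, rank v ≤ m → (∃ k, TerminalWithin E S k v) → Reaches E s v := by
    intro m
    induction m with
    | zero =>
      intro v hm hk
      have hmem := Nat.sInf_mem (s := {k | TerminalWithin E S k v}) hk
      have h0 : sInf {k | TerminalWithin E S k v} = 0 := Nat.le_zero.mp hm
      rw [h0] at hmem
      exact ⟨0, hmem⟩
    | succ m ih =>
      rintro v hm ⟨k, hk⟩
      by_cases hv : Terminal E v
      · exact ⟨0, hv⟩
      · obtain ⟨_, hk', hlt⟩ := hs v hv (unhit k v hk)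
        obtain ⟨j, hj⟩ := ih (s v) (by omega) hk'
        exact ⟨j + 1, hj⟩
  rintro v hv ⟨w, hw, h⟩
  exact ⟨(hs v hv ⟨w, hw, h⟩).1, reach _ v le_rfl (hit v w hw h)⟩

end LocalOptimality

section Regions

variable {V : Type} {E : V → V → Prop} {owner : V → Fin 2} {L : Fin 2 → V → ℝ}

/-- An edge between two non-terminal positions of the same player. -/
def InternalEdge (E : V → V → Prop) (owner : V → Fin 2) (u v : V) : Prop :=
  E u v ∧ ¬ Terminal E v ∧ owner u = owner v

/-- `v` is in the monochromatic region of `u`. -/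
abbrev SameRegion (E : V → V → Prop) (owner : V → Fin 2) : V → V → Prop :=
  Relation.ReflTransGen (InternalEdge E owner)

lemma InternalEdge.symm (hsym : EdgeSymm E) {u v : V} (h : InternalEdge E owner u v) :
    InternalEdge E owner v u :=
  ⟨hsym u v h.1 h.2.1, fun ht => ht v h.1, h.2.2.symm⟩

lemma SameRegion.symm (hsym : EdgeSymm E) {u v : V} (h : SameRegion E owner u v) :
    SameRegion E owner v u := by
  induction h with
  | refl => exact .refl
  | tail _ h ih => exact .head (h.symm hsym) ih

lemma SameRegion.owner_eq {u v : V} (h : SameRegion E owner u v) : owner u = owner v := by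
  induction h with
  | refl => rfl
  | tail _ h ih => exact ih.trans h.2.2

lemma SameRegion.mem_of_mem {D : Set V} (hD : ∀ u v, InternalEdge E owner u v → u ∈ D → v ∈ D)
    {u v : V} (h : SameRegion E owner u v) (hu : u ∈ D) : v ∈ D := by
  induction h with
  | refl => exact hu
  | tail _ h ih => exact hD _ _ h ih

/-- The move from `r` to `u` is, for the owner of `r`, a best way to enter `D` from the region
of `r`. -/
structure IsBestEntry (E : V → V → Prop) (owner : V → Fin 2) (D : Set V) (val : V → Fin 2 → ℝ)
    (r u : V) : Prop where
  notMem : r ∉ D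
  edge : E r u
  mem : u ∈ D
  le : ∀ r' u', SameRegion E owner r r' → E r' u' → u' ∈ D → val u (owner r) ≤ val u' (owner r)

/-- The costs of a position, compared lexicographically. -/
def lexCost (val : V → Fin 2 → ℝ) (v : V) : ℝ ×ₗ ℝ := toLex (val v 0, val v 1)

/-- The value function `val` describes an equilibrium on the union of regions `D`, and all
further entries to `D` are lexicographically no better than the values already assigned. -/
structure IsPartialSolution (E : V → V → Prop) (owner : V → Fin 2) (L : Fin 2 → V → ℝ)
    (D : Set V) (val : V → Fin 2 → ℝ) : Prop where
  terminal_mem : ∀ w, Terminal E w → w ∈ D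
  val_terminal : ∀ w, Terminal E w → ∀ i, val w i = L i w
  closed : ∀ u v, InternalEdge E owner u v → u ∈ D → v ∈ D
  path : ∀ v ∈ D, ∃ w, Terminal E w ∧
    Relation.ReflTransGen (fun x y => E x y ∧ x ∈ D ∧ y ∈ D ∧ val x = val y) v w
  opt : ∀ u ∈ D, ∀ v ∈ D, E u v → val u (owner u) ≤ val v (owner u)
  lex_le : ∀ v ∈ D, ¬ Terminal E v → ∀ r u, IsBestEntry E owner D val r u →
    lexCost val v ≤ lexCost val u

lemma isPartialSolution_terminals (E : V → V → Prop) (owner : V → Fin 2) (L : Fin 2 → V → ℝ) :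
    IsPartialSolution E owner L {v | Terminal E v} (fun v i => L i v) where
  terminal_mem _ hw := hw
  val_terminal _ _ _ := rfl
  closed _ v h hu := absurd h.1 (hu v)
  path v hv := ⟨v, hv, .refl⟩
  opt _ hu v _ h := absurd h (hu v)
  lex_le _ hv hv' := absurd hv hv'

lemma exists_isBestEntry [Finite V] {D : Set V} {val : V → Fin 2 → ℝ}
    (hclosed : ∀ u v, InternalEdge E owner u v → u ∈ D → v ∈ D) (hsym : EdgeSymm E)
    {r u : V} (hr : r ∉ D) (hu : u ∈ D) (h : E r u) : ∃ r' u', IsBestEntry E owner D val r' u' := by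
  obtain ⟨⟨r', u'⟩, ⟨hr', hE, hu'⟩, hmin⟩ := Set.exists_min_image
    {p : V × V | SameRegion E owner r p.1 ∧ E p.1 p.2 ∧ p.2 ∈ D}
    (fun p => val p.2 (owner r)) (Set.toFinite _) ⟨(r, u), .refl, h, hu⟩
  refine ⟨r', u', fun hD => hr ((SameRegion.symm hsym hr').mem_of_mem hclosed hD), hE, hu', ?_⟩
  intro r'' u'' h'' hE'' hu''
  rw [← SameRegion.owner_eq hr']
  exact hmin (r'', u'') ⟨hr'.trans h'', hE'', hu''⟩

/-- A partial solution with an entry can be extended by a region with the lexicographically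
best entry. -/
lemma IsPartialSolution.exists_extension [Finite V] {D : Set V} {val : V → Fin 2 → ℝ}
    (hD : IsPartialSolution E owner L D val) (hsym : EdgeSymm E)
    (hex : ∃ r u, r ∉ D ∧ u ∈ D ∧ E r u) :
    ∃ D' val', D ⊂ D' ∧ IsPartialSolution E owner L D' val' := by
  obtain ⟨r₀, u₀, hr₀, hu₀, h₀⟩ := hex
  obtain ⟨r₁, u₁, h₁⟩ := exists_isBestEntry (val := val) hD.closed hsym hr₀ hu₀ h₀
  obtain ⟨⟨r, u⟩, hru, hmin⟩ := Set.exists_min_image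
    {p : V × V | IsBestEntry E owner D val p.1 p.2} (fun p => lexCost val p.2)
    (Set.toFinite _) ⟨(r₁, u₁), h₁⟩
  replace hru : IsBestEntry E owner D val r u := hru
  replace hmin : ∀ r' u', IsBestEntry E owner D val r' u' → lexCost val u ≤ lexCost val u' :=
    fun r' u' h => hmin (r', u') h
  let C : Set V := {v | SameRegion E owner r v}
  let val' : V → Fin 2 → ℝ := fun v => if v ∈ C then val u else val v
  have hCD : ∀ v ∈ C, v ∉ D := fun v hv hvD =>
    hru.notMem ((SameRegion.symm hsym hv).mem_of_mem hD.closed hvD)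
  have valC : ∀ v ∈ C, val' v = val u := fun v hv => if_pos hv
  have valD : ∀ v ∈ D, val' v = val v := fun v hv => if_neg fun hC => hCD v hC hv
  have lexC : ∀ v ∈ C, lexCost val' v = lexCost val u := fun v hv => by
    simp only [lexCost, valC v hv]
  have lexD : ∀ v ∈ D, lexCost val' v = lexCost val v := fun v hv => by
    simp only [lexCost, valD v hv]
  have nonterm : ∀ v ∉ D, ¬ Terminal E v := fun v hv ht => hv (hD.terminal_mem v ht)
  have hrC : r ∈ C := .refl
  have pathD : ∀ v ∈ D, ∃ w, Terminal E w ∧ Relation.ReflTransGen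
      (fun x y => E x y ∧ x ∈ D ∪ C ∧ y ∈ D ∪ C ∧ val' x = val' y) v w := by
    intro v hv
    obtain ⟨w, hw, h⟩ := hD.path v hv
    refine ⟨w, hw, Relation.ReflTransGen.mono ?_ _ _ h⟩
    rintro x y ⟨hxy, hx, hy, he⟩
    exact ⟨hxy, Or.inl hx, Or.inl hy, by rw [valD x hx, valD y hy, he]⟩
  have pathC : ∀ v ∈ C, Relation.ReflTransGen
      (fun x y => E x y ∧ x ∈ D ∪ C ∧ y ∈ D ∪ C ∧ val' x = val' y) v r := by
    intro v hv
    induction hv with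
    | refl => exact .refl
    | @tail b c hb hbc ih =>
      have hc : c ∈ C := Relation.ReflTransGen.tail hb hbc
      exact .head ⟨(hbc.symm hsym).1, Or.inr hc, Or.inr hb, by rw [valC c hc, valC b hb]⟩ ih
  refine ⟨D ∪ C, val', ?_, ?_, ?_, ?_, ?_, ?_, ?_⟩
  · exact ⟨Set.subset_union_left, fun h => hru.notMem (h (Or.inr hrC))⟩
  · exact fun w hw => Or.inl (hD.terminal_mem w hw)
  · intro w hw i
    rw [valD w (hD.terminal_mem w hw), hD.val_terminal w hw]
  · rintro x y hxy (hx | hx)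
    · exact Or.inl (hD.closed x y hxy hx)
    · exact Or.inr (Relation.ReflTransGen.tail hx hxy)
  · rintro v (hv | hv)
    · exact pathD v hv
    · obtain ⟨w, hw, h⟩ := pathD u hru.mem
      refine ⟨w, hw, (pathC v hv).trans (.head ⟨hru.edge, Or.inr hrC, Or.inl hru.mem, ?_⟩ h)⟩
      rw [valC r hrC, valD u hru.mem]
  · rintro x (hx | hx) y (hy | hy) hxy
    · rw [valD x hx, valD y hy]
      exact hD.opt x hx y hy hxy
    · rw [valD x hx, valC y hy]
      have hyx : E y x := hsym x y hxy (nonterm y (hCD y hy))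
      have howner : owner x ≠ owner y := fun he =>
        hCD y hy (hD.closed x y ⟨hxy, nonterm y (hCD y hy), he⟩ hx)
      have hlex := hD.lex_le x hx (fun ht => ht y hxy) r u hru
      have hle := hru.le y x hy hyx hx
      rw [SameRegion.owner_eq hy] at hle
      rw [lexCost, lexCost, Prod.Lex.toLex_le_toLex] at hlex
      simp only at hlex
      generalize owner x = a at *
      generalize owner y = b at *
      fin_cases a <;> fin_cases b <;> simp at howner hle ⊢
      · rcases hlex with h | h
        · exact h.le
        · exact h.1.le
      · rcases hlex with h | h
        · exact absurd h hle.not_gt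
        · exact h.2
    · rw [valC x hx, valD y hy, ← SameRegion.owner_eq hx]
      exact hru.le x y hx hxy hy
    · rw [valC x hx, valC y hy]
  · intro v hv hvt r' u' h'
    have hvu : lexCost val' v ≤ lexCost val u := by
      rcases hv with hv | hv
      · rw [lexD v hv]
        exact hD.lex_le v hv hvt r u hru
      · rw [lexC v hv]
    refine hvu.trans ?_
    rcases h'.mem with hu' | hu'
    · rw [lexD u' hu']
      refine hmin r' u' ⟨fun h => h'.notMem (Or.inl h), h'.edge, hu', ?_⟩
      intro r'' u'' hr'' hE hu''
      have := h'.le r'' u'' hr'' hE (Or.inl hu'')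
      rwa [valD u' hu', valD u'' hu''] at this
    · rw [lexC u' hu']

lemma exists_isPartialSolution_no_entry [Finite V] (hsym : EdgeSymm E) :
    ∃ D val, IsPartialSolution E owner L D val ∧ ∀ r u, E r u → u ∈ D → r ∈ D := by
  obtain ⟨D, ⟨val, hD⟩, hmax⟩ := (Set.toFinite
    {D : Set V | ∃ val, IsPartialSolution E owner L D val}).exists_maximal
    ⟨_, _, isPartialSolution_terminals E owner L⟩
  refine ⟨D, val, hD, fun r u hE hu => ?_⟩
  by_contra hr
  obtain ⟨D', val', hlt, hD'⟩ := hD.exists_extension hsym ⟨r, u, hr, hu, hE⟩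
  exact hlt.2 (hmax ⟨val', hD'⟩ hlt.1)

end Regions

/-- Every terminal game satisfying (TWO) `n = 2` players,
(SYM) edge-symmetry, and (CIW) `𝓛ⁱ(w) < 0` for every player `i` and terminal
`w`, has a uniform Nash equilibrium in pure stationary strategies. -/
theorem two_person_edgeSymmetric_CIW_terminalGame_has_UNE
    {V : Type} [Fintype V]
    (E : V → V → Prop) (owner : V → Fin 2) (L : Fin 2 → V → ℝ) (v0 : V)
    (hT : ∃ v, Terminal E v)        -- the set of terminals is nonempty
    (hv0 : ¬ Terminal E v0)         -- the initial position is not terminal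
    (hsym : EdgeSymm E)             -- (SYM)
    (hCIW : ∀ i w, Terminal E w → L i w < 0)  -- (CIW)
    :
    ∃ s, IsUNE E owner L s := by
  obtain ⟨D, val, hD, hback⟩ := exists_isPartialSolution_no_entry (owner := owner) (L := L) hsym
  have hforth : ∀ x y, E x y → x ∈ D → y ∈ D := fun x y hxy hx => by
    by_cases hy : Terminal E y
    · exact hD.terminal_mem y hy
    · exact hback y x (hsym x y hxy hy) hx
  let S : V → V → Prop := fun x y => E x y ∧ x ∈ D ∧ y ∈ D ∧ val x = val y
  have hmem : ∀ x, (∃ w, Terminal E w ∧ Relation.ReflTransGen S x w) ↔ x ∈ D := by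
    refine fun x => ⟨?_, hD.path x⟩
    rintro ⟨w, hw, h⟩
    rcases h.cases_head with rfl | ⟨_, h, _⟩
    · exact hD.terminal_mem x hw
    · exact h.2.1
  have hmove : ∀ x, ∃ y, ¬ Terminal E x → E x y := fun x => by
    by_cases hx : Terminal E x
    · exact ⟨x, fun h => absurd hx h⟩
    · simp only [Terminal, not_forall, not_not] at hx
      exact hx.imp fun _ h _ => h
  choose g hg using hmove
  obtain ⟨s, hsD, hsg⟩ := exists_reaching_strategy E S g
  simp only [hmem] at hsD hsg
  have hs : IsSituation E s := fun x hx => by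
    by_cases hxD : x ∈ D
    · exact (hsD x hx hxD).1.1
    · rw [hsg x hxD]
      exact hg x hx
  have hval : ∀ x ∈ D, ∀ i, val x i ≤ 0 := fun x hx i => by
    obtain ⟨w, hw, h⟩ := hD.path x hx
    have : val x = val w := by
      clear hw
      induction h with
      | refl => rfl
      | tail _ h ih => exact ih.trans h.2.2.2
    rw [this, hD.val_terminal w hw]
    exact (hCIW i w hw).le
  refine ⟨s, isUNE_of_locally_optimal (val := fun x => if x ∈ D then val x else 0) hs ?_ ?_ ?_ ?_ ?_⟩
  · intro x i
    by_cases hx : x ∈ D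
    · simpa only [if_pos hx] using hval x hx i
    · simp [hx]
  · intro w hw i
    simpa only [if_pos (hD.terminal_mem w hw)] using hD.val_terminal w hw i
  · intro x hx
    by_cases hxD : x ∈ D
    · have h := (hsD x hx hxD).1
      simpa only [if_pos hxD, if_pos h.2.2.1] using h.2.2.2
    · have : s x ∉ D := fun h => hxD (hback x (s x) (hs x hx) h)
      simp [hxD, this]
  · intro x hx i
    have hxD : x ∉ D := fun h =>
      hx (hsD x (fun ht => hx ⟨0, ht⟩) h).2
    simp [hxD]
  · intro x y hxy
    by_cases hxD : x ∈ D
    · have hyD := hforth x y hxy hxD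
      simpa only [if_pos hxD, if_pos hyD] using hD.opt x hxD y hyD hxy
    · have hyD : y ∉ D := fun h => hxD (hback x y hxy h)
      simp [hxD, hyD]
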